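/- Suppose 0 < σ < 1 and fix α > 0. Define f(T) = ∫_{(0,∞)^p} (1 − e^{−α ψ(2Tw₁,…,2Tw_p)}) ρ(dw). Then f(T) = Θ(T^σ) as T → ∞: there exist constants 0 < c₁ ≤ c₂ < ∞ and T₀ > 0 such that c₁ T^σ ≤ f(T) ≤ c₂ T^σ for all T ≥ T₀. Consequently the expected number of nodes E[V_{α,T}] = α f(T) satisfies E[V_{α,T}] = Θ(T^σ) as T → ∞. -/

import Mathlib

open MeasureTheory Real Filter

/-- The Lévy measure of a generalized gamma process: the measure on `(0,∞)` with density
`w ↦ w^(-1-σ) * exp(-τ*w) / Γ(1-σ)` with respect to Lebesgue measure. -/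
noncomputable def rho0 (σ τ : ℝ) : Measure ℝ :=
  ((volume : Measure ℝ).restrict (Set.Ioi 0)).withDensity
    (fun w => ENNReal.ofReal (w ^ (-1 - σ) * Real.exp (-τ * w) / Real.Gamma (1 - σ)))

/-- The Gamma(a,b) probability measure on `(0,∞)`, with density
`x ↦ b^a x^(a−1) e^(−b x) / Γ(a)` with respect to Lebesgue measure. -/
noncomputable def gammaM (a b : ℝ) : Measure ℝ :=
  ((volume : Measure ℝ).restrict (Set.Ioi 0)).withDensity
    (fun x => ENNReal.ofReal (b ^ a * x ^ (a - 1) * Real.exp (-b * x) / Real.Gamma a))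

/-- The multivariate Lévy measure `ρ` of the compound CRM with independent gamma scores:
the pushforward of `ρ₀ ⊗ Gamma(a₁,b₁) ⊗ ⋯ ⊗ Gamma(a_p,b_p)` under
`(w₀, β₁, …, β_p) ↦ (w₀β₁, …, w₀β_p)`. -/
noncomputable def rhoC (σ τ : ℝ) (p : ℕ) (a b : Fin p → ℝ) : Measure (Fin p → ℝ) :=
  Measure.map (fun x : ℝ × (Fin p → ℝ) => fun k => x.1 * x.2 k)
    ((rho0 σ τ).prod (Measure.pi fun k => gammaM (a k) (b k)))

/-- The Laplace exponent `ψ(t) = ∫ (1 − e^{−Σ_k t_k v_k}) ρ(dv)` of the compound CRM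
(a finite quantity, expressed here as a Bochner integral). -/
noncomputable def psi (σ τ : ℝ) (p : ℕ) (a b : Fin p → ℝ) (t : Fin p → ℝ) : ℝ :=
  ∫ v, (1 - Real.exp (-∑ k, t k * v k)) ∂(rhoC σ τ p a b)

/-- `∫ (1 − e^{−α ψ(2Tw₁,…,2Tw_p)}) ρ(dw)`, so that `E[V_{α,T}]` equals `α` times this. -/
noncomputable def nodesIntegral (σ τ : ℝ) (p : ℕ) (a b : Fin p → ℝ) (α T : ℝ) : ℝ :=
  ∫ w, (1 - Real.exp (-α * psi σ τ p a b (fun k => 2 * T * w k))) ∂(rhoC σ τ p a b)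

lemma integrable_withDensity_ofReal_Ioi_iff {d g : ℝ → ℝ} (hd : Measurable d)
    (hd0 : ∀ x, 0 < x → 0 < d x) :
    Integrable g (((volume : Measure ℝ).restrict (Set.Ioi 0)).withDensity
      (fun x => ENNReal.ofReal (d x))) ↔ IntegrableOn (fun x => d x * g x) (Set.Ioi 0) := by
  rw [integrable_withDensity_iff_integrable_smul' hd.ennreal_ofReal (by simp)]
  refine integrableOn_congr_fun (fun x hx => ?_) measurableSet_Ioi
  simp [ENNReal.toReal_ofReal (hd0 x hx).le]

lemma integral_withDensity_ofReal_Ioi {d : ℝ → ℝ} (g : ℝ → ℝ) (hd : Measurable d)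
    (hd0 : ∀ x, 0 < x → 0 < d x) :
    ∫ x, g x ∂(((volume : Measure ℝ).restrict (Set.Ioi 0)).withDensity
      (fun x => ENNReal.ofReal (d x))) = ∫ x in Set.Ioi 0, d x * g x := by
  rw [integral_withDensity_eq_integral_toReal_smul hd.ennreal_ofReal (by simp)]
  refine setIntegral_congr_fun measurableSet_Ioi (fun x hx => ?_)
  simp [ENNReal.toReal_ofReal (hd0 x hx).le]

lemma withDensity_ofReal_Ioi_ne_zero {d : ℝ → ℝ} (hd : Measurable d)
    (hd0 : ∀ x, 0 < x → 0 < d x) :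
    ((volume : Measure ℝ).restrict (Set.Ioi 0)).withDensity
      (fun x => ENNReal.ofReal (d x)) ≠ 0 := by
  intro h
  rw [withDensity_eq_zero_iff hd.ennreal_ofReal.aemeasurable] at h
  have h2 : (volume : Measure ℝ).restrict (Set.Ioi 0) = 0 := by
    rw [← ae_eq_bot, ← Filter.eventually_false_iff_eq_bot]
    filter_upwards [h, ae_restrict_mem measurableSet_Ioi] with x hx hx0
    have := hd0 x hx0
    simp only [Pi.zero_apply, ENNReal.ofReal_eq_zero] at hx
    linarith
  simp [Measure.restrict_eq_zero] at h2

lemma ae_pos_withDensity_restrict_Ioi (d : ℝ → ENNReal) :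
    ∀ᵐ x ∂((volume : Measure ℝ).restrict (Set.Ioi 0)).withDensity d, 0 < x :=
  (withDensity_absolutelyContinuous _ _).ae_le (ae_restrict_mem measurableSet_Ioi)

lemma integral_pos_of_ae_pos {Ω : Type*} [MeasurableSpace Ω] {μ : Measure Ω} (hμ : μ ≠ 0)
    {f : Ω → ℝ} (hf : Integrable f μ) (hpos : ∀ᵐ x ∂μ, 0 < f x) : 0 < ∫ x, f x ∂μ := by
  rw [integral_pos_iff_support_of_nonneg_ae (hpos.mono fun x hx => hx.le) hf, pos_iff_ne_zero]
  intro h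
  apply hμ
  rw [← ae_eq_bot, ← Filter.eventually_false_iff_eq_bot]
  filter_upwards [hpos, measure_eq_zero_iff_ae_notMem.1 h] with x hx hx'
  exact hx' hx.ne'

lemma gammaDensity_pos {a b : ℝ} (ha : 0 < a) (hb : 0 < b) (x : ℝ) (hx : 0 < x) :
    0 < b ^ a * x ^ (a - 1) * Real.exp (-b * x) / Real.Gamma a := by
  have := Real.Gamma_pos_of_pos ha
  positivity

lemma integrableOn_rpow_mul_exp_neg {s b : ℝ} (hs : -1 < s) (hb : 0 < b) :
    IntegrableOn (fun x : ℝ => x ^ s * Real.exp (-b * x)) (Set.Ioi 0) := by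
  simpa using integrableOn_rpow_mul_exp_neg_mul_rpow hs one_pos hb

lemma isFiniteMeasure_gammaM {a b : ℝ} (ha : 0 < a) (hb : 0 < b) :
    IsFiniteMeasure (gammaM a b) := by
  refine isFiniteMeasure_withDensity_ofReal (Integrable.hasFiniteIntegral ?_)
  have := (integrableOn_rpow_mul_exp_neg (s := a - 1) (by linarith) hb).const_mul
    (b ^ a / Real.Gamma a)
  refine this.congr (Eventually.of_forall fun x => ?_)
  simp only
  ring

lemma gammaM_ne_zero {a b : ℝ} (ha : 0 < a) (hb : 0 < b) : gammaM a b ≠ 0 :=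
  withDensity_ofReal_Ioi_ne_zero (by fun_prop) (gammaDensity_pos ha hb)

lemma integrable_id_gammaM {a b : ℝ} (ha : 0 < a) (hb : 0 < b) :
    Integrable id (gammaM a b) := by
  rw [gammaM, integrable_withDensity_ofReal_Ioi_iff (by fun_prop) (gammaDensity_pos ha hb)]
  refine IntegrableOn.congr_fun
    ((integrableOn_rpow_mul_exp_neg (s := a) (by linarith) hb).const_mul
    (b ^ a / Real.Gamma a)) (fun x hx => ?_) measurableSet_Ioi
  have : x ^ a = x ^ (a - 1) * x := by
    rw [← Real.rpow_add_one (ne_of_gt hx), sub_add_cancel]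
  simp only [this, id]
  ring

lemma rho0Density_pos {σ : ℝ} (τ : ℝ) (hσ : σ < 1) (w : ℝ) (hw : 0 < w) :
    0 < w ^ (-1 - σ) * Real.exp (-τ * w) / Real.Gamma (1 - σ) := by
  have := Real.Gamma_pos_of_pos (sub_pos.2 hσ)
  positivity

instance sigmaFinite_rho0 (σ τ : ℝ) : SigmaFinite (rho0 σ τ) :=
  SigmaFinite.withDensity_ofReal _

instance sigmaFinite_gammaM (a b : ℝ) : SigmaFinite (gammaM a b) :=
  SigmaFinite.withDensity_ofReal _

lemma integrable_id_rho0 {σ τ : ℝ} (hσ : σ < 1) (hτ : 0 < τ) :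
    Integrable (fun w => w) (rho0 σ τ) := by
  rw [rho0, integrable_withDensity_ofReal_Ioi_iff (by fun_prop) (rho0Density_pos τ hσ)]
  refine IntegrableOn.congr_fun
    ((integrableOn_rpow_mul_exp_neg (s := -σ) (by linarith) hτ).const_mul
    (1 / Real.Gamma (1 - σ))) (fun x hx => ?_) measurableSet_Ioi
  have : x ^ (-σ) = x ^ (-1 - σ) * x := by
    rw [← Real.rpow_add_one (ne_of_gt hx)]; congr 1; ring
  simp only [this]
  ring

lemma integrable_min_one_mul_rho0 {σ τ : ℝ} (hσ : σ < 1) (hτ : 0 < τ) {T : ℝ} (hT : 0 < T) :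
    Integrable (fun w => min 1 (T * w)) (rho0 σ τ) := by
  refine ((integrable_id_rho0 hσ hτ).const_mul T).mono' (by fun_prop) ?_
  filter_upwards [ae_pos_withDensity_restrict_Ioi _] with w hw
  rw [Real.norm_of_nonneg (by positivity)]
  exact min_le_right _ _

lemma integrableOn_rpow_mul_min_one {σ : ℝ} (hσ0 : 0 < σ) (hσ : σ < 1) :
    IntegrableOn (fun u : ℝ => u ^ (-1 - σ) * min 1 u) (Set.Ioi 0) := by
  rw [← Set.Ioc_union_Ioi_eq_Ioi zero_le_one]
  refine IntegrableOn.union ?_ ?_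
  · have h := (intervalIntegral.intervalIntegrable_rpow' (a := 0) (b := 1)
      (r := -σ) (by linarith))
    rw [intervalIntegrable_iff_integrableOn_Ioc_of_le zero_le_one] at h
    refine h.congr_fun (fun x hx => ?_) measurableSet_Ioc
    simp only [min_eq_right hx.2]
    rw [← Real.rpow_add_one (ne_of_gt hx.1)]; congr 1; ring
  · refine (integrableOn_Ioi_rpow_of_lt (a := -1 - σ) (by linarith) one_pos).congr_fun
      (fun x hx => ?_) measurableSet_Ioi
    simp only [min_eq_left (le_of_lt (Set.mem_Ioi.1 hx)), mul_one]

/-- Up to a constant, `∫ min(1, T w) ρ₀(dw)` grows at most like `T ^ σ`. -/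
lemma integral_min_one_mul_rho0_le {σ τ : ℝ} (hσ0 : 0 < σ) (hσ : σ < 1) (hτ : 0 < τ)
    {T : ℝ} (hT : 0 < T) :
    ∫ w, min 1 (T * w) ∂(rho0 σ τ) ≤
      (∫ u in Set.Ioi (0 : ℝ), u ^ (-1 - σ) * min 1 u) / Real.Gamma (1 - σ) * T ^ σ := by
  have hΓ := Real.Gamma_pos_of_pos (sub_pos.2 hσ)
  have h_base := integrableOn_rpow_mul_min_one hσ0 hσ
  have heq : ∀ w ∈ Set.Ioi (0 : ℝ), (T / Real.Gamma (1 - σ) * T ^ σ) *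
        ((T * w) ^ (-1 - σ) * min 1 (T * w)) =
      w ^ (-1 - σ) / Real.Gamma (1 - σ) * min 1 (T * w) := by
    intro w hw
    have h1 : T ^ (-1 - σ) * T ^ σ * T = 1 := by
      rw [← Real.rpow_add hT, ← Real.rpow_add_one hT.ne']
      simp
    rw [Real.mul_rpow hT.le (le_of_lt hw)]
    linear_combination (w ^ (-1 - σ) / Real.Gamma (1 - σ) * min 1 (T * w)) * h1
  have h_scaled : IntegrableOn (fun w => w ^ (-1 - σ) / Real.Gamma (1 - σ) * min 1 (T * w))
      (Set.Ioi 0) := by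
    have h := (integrableOn_Ioi_comp_mul_left_iff
      (fun u : ℝ => u ^ (-1 - σ) * min 1 u) 0 hT).2 (by simpa using h_base)
    exact IntegrableOn.congr_fun (h.const_mul (T / Real.Gamma (1 - σ) * T ^ σ)) heq
      measurableSet_Ioi
  rw [rho0, integral_withDensity_ofReal_Ioi _ (by fun_prop) (rho0Density_pos τ hσ)]
  calc _ ≤ ∫ w in Set.Ioi (0 : ℝ), w ^ (-1 - σ) / Real.Gamma (1 - σ) * min 1 (T * w) := by
        refine integral_mono_of_nonneg ?_ h_scaled ?_
        · filter_upwards [ae_restrict_mem measurableSet_Ioi] with w hw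
          have := rho0Density_pos τ hσ w hw
          have hw' : 0 < w := hw
          simp only [Pi.zero_apply]
          positivity
        · filter_upwards [ae_restrict_mem measurableSet_Ioi] with w hw
          have hw' : 0 < w := hw
          have h1 : Real.exp (-τ * w) ≤ 1 := Real.exp_le_one_iff.2 (by nlinarith)
          have h2 : (0 : ℝ) ≤ w ^ (-1 - σ) := by positivity
          gcongr
          exact mul_le_of_le_one_right h2 h1
    _ = (T / Real.Gamma (1 - σ) * T ^ σ) *
        ∫ w in Set.Ioi (0 : ℝ), ((T * w) ^ (-1 - σ) * min 1 (T * w)) := by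
        rw [← integral_const_mul]
        exact (setIntegral_congr_fun measurableSet_Ioi heq).symm
    _ = _ := by
        rw [integral_comp_mul_left_Ioi (fun u : ℝ => u ^ (-1 - σ) * min 1 u) 0 hT]
        simp only [mul_zero, smul_eq_mul]
        field_simp

/-- Up to a constant, `ρ₀ (1/T, 2/T]` grows at least like `T ^ σ`. -/
lemma le_integral_indicator_rho0 {σ τ : ℝ} (hσ0 : 0 < σ) (hσ : σ < 1) (hτ : 0 < τ)
    {T : ℝ} (hT : 1 ≤ T) :
    2 ^ (-1 - σ) * Real.exp (-τ * 2) / Real.Gamma (1 - σ) * T ^ σ ≤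
      ∫ w, (Set.Ioc (1 / T) (2 / T)).indicator 1 w ∂(rho0 σ τ) := by
  have hΓ := Real.Gamma_pos_of_pos (sub_pos.2 hσ)
  have hT0 : 0 < T := by linarith
  set s := Set.Ioc (1 / T) (2 / T)
  have hs : MeasurableSet s := measurableSet_Ioc
  set c := (2 / T) ^ (-1 - σ) * Real.exp (-τ * 2) / Real.Gamma (1 - σ) with hc
  have hc0 : 0 < c := by positivity
  have hmin : ∀ w, 0 < w → s.indicator (1 : ℝ → ℝ) w ≤ min 1 (T * w) := by
    intro w hw
    by_cases hws : w ∈ s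
    · have h1 := hws.1
      rw [div_lt_iff₀ hT0] at h1
      simp only [Set.indicator_of_mem hws, Pi.one_apply]
      exact le_min le_rfl (by linarith)
    · simp only [Set.indicator_of_notMem hws]
      positivity
  have hind : Integrable (s.indicator (1 : ℝ → ℝ)) (rho0 σ τ) := by
    refine (integrable_min_one_mul_rho0 hσ hτ hT0).mono'
      ((measurable_const.indicator hs).aestronglyMeasurable) ?_
    filter_upwards [ae_pos_withDensity_restrict_Ioi _] with w hw
    rw [Real.norm_of_nonneg (Set.indicator_nonneg (by simp) _)]
    exact hmin w hw
  rw [rho0, integrable_withDensity_ofReal_Ioi_iff (by fun_prop) (rho0Density_pos τ hσ)] at hind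
  rw [rho0, integral_withDensity_ofReal_Ioi _ (by fun_prop) (rho0Density_pos τ hσ)]
  have hsub : s ⊆ Set.Ioi 0 := fun w hw => lt_trans (by positivity) hw.1
  calc _ = ∫ w in Set.Ioi (0 : ℝ), s.indicator (fun _ => c) w := by
        rw [setIntegral_indicator hs, Set.inter_eq_right.2 hsub, setIntegral_const]
        have : (volume : Measure ℝ).real s = 1 / T := by
          rw [Measure.real, Real.volume_Ioc, ENNReal.toReal_ofReal]
          · ring
          · rw [← sub_div]; norm_num; positivity
        rw [this, hc, Real.div_rpow (by norm_num) hT0.le, smul_eq_mul]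
        have h1 : T ^ (-1 - σ) * T ^ σ * T = 1 := by
          rw [← Real.rpow_add hT0, ← Real.rpow_add_one hT0.ne']
          simp
        have h2 : 0 < T ^ (-1 - σ) := by positivity
        field_simp
        linear_combination h1
    _ ≤ _ := by
        refine integral_mono_of_nonneg ?_ hind ?_
        · exact Eventually.of_forall fun w => Set.indicator_nonneg (fun _ _ => hc0.le) _
        · refine Eventually.of_forall fun w => ?_
          by_cases hws : w ∈ s
          · have hw0 : 0 < w := hsub hws
            have h2 := hws.2
            have h3 : w ≤ 2 := h2.trans (div_le_self (by norm_num) hT)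
            simp only [Set.indicator_of_mem hws, Pi.one_apply, mul_one, hc]
            gcongr ?_ * Real.exp ?_ / _
            · exact Real.rpow_le_rpow_of_nonpos hw0 h2 (by linarith)
            · nlinarith
          · simp [Set.indicator_of_notMem hws]

section Compound

variable {σ τ : ℝ} {p : ℕ} {a b : Fin p → ℝ}

instance sFinite_rhoC : SFinite (rhoC σ τ p a b) := by
  unfold rhoC; infer_instance

lemma integral_rhoC {f : (Fin p → ℝ) → ℝ} (hf : Measurable f) :
    ∫ v, f v ∂(rhoC σ τ p a b) =
      ∫ x, f (fun k => x.1 * x.2 k)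
        ∂((rho0 σ τ).prod (Measure.pi fun k => gammaM (a k) (b k))) :=
  integral_map (by fun_prop) hf.aestronglyMeasurable

lemma integrable_rhoC_iff {f : (Fin p → ℝ) → ℝ} (hf : Measurable f) :
    Integrable f (rhoC σ τ p a b) ↔ Integrable (fun x => f (fun k => x.1 * x.2 k))
      ((rho0 σ τ).prod (Measure.pi fun k => gammaM (a k) (b k))) :=
  integrable_map_measure hf.aestronglyMeasurable (by fun_prop)

lemma ae_pos_pi_gammaM (ha : ∀ k, 0 < a k) (hb : ∀ k, 0 < b k) :
    ∀ᵐ x ∂(Measure.pi fun k => gammaM (a k) (b k)), ∀ k, 0 < x k := by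
  have := fun k => isFiniteMeasure_gammaM (ha k) (hb k)
  refine ae_all_iff.2 fun k => ?_
  exact (Measure.quasiMeasurePreserving_eval (fun k => gammaM (a k) (b k)) k).ae
    (ae_pos_withDensity_restrict_Ioi _)

lemma ae_pos_prod (ha : ∀ k, 0 < a k) (hb : ∀ k, 0 < b k) :
    ∀ᵐ x ∂((rho0 σ τ).prod (Measure.pi fun k => gammaM (a k) (b k))),
      0 < x.1 ∧ ∀ k, 0 < x.2 k := by
  have := fun k => isFiniteMeasure_gammaM (ha k) (hb k)
  exact (Measure.quasiMeasurePreserving_fst.ae (ae_pos_withDensity_restrict_Ioi _)).and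
    (Measure.quasiMeasurePreserving_snd.ae (ae_pos_pi_gammaM ha hb))

lemma ae_pos_rhoC (ha : ∀ k, 0 < a k) (hb : ∀ k, 0 < b k) :
    ∀ᵐ v ∂(rhoC σ τ p a b), ∀ k, 0 < v k := by
  rw [rhoC, ae_map_iff (by fun_prop)]
  · filter_upwards [ae_pos_prod ha hb] with x hx k using mul_pos hx.1 (hx.2 k)
  · rw [Set.ofPred_forall]
    exact MeasurableSet.iInter fun k => measurableSet_lt measurable_const (measurable_pi_apply k)

lemma rhoC_ne_zero (hσ : σ < 1) (ha : ∀ k, 0 < a k) (hb : ∀ k, 0 < b k) :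
    rhoC σ τ p a b ≠ 0 := by
  have := fun k => isFiniteMeasure_gammaM (ha k) (hb k)
  rw [rhoC, Ne, Measure.map_eq_zero_iff (by fun_prop), ← Measure.measure_univ_eq_zero,
    ← Set.univ_prod_univ, Measure.prod_prod, mul_eq_zero, Measure.measure_univ_eq_zero, not_or]
  refine ⟨withDensity_ofReal_Ioi_ne_zero (by fun_prop) (rho0Density_pos τ hσ), ?_⟩
  rw [Measure.pi_univ, Finset.prod_eq_zero_iff]
  rintro ⟨k, -, hk⟩
  exact gammaM_ne_zero (ha k) (hb k) (Measure.measure_univ_eq_zero.1 hk)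

lemma integrable_eval_rhoC (hσ : σ < 1) (hτ : 0 < τ) (ha : ∀ k, 0 < a k) (hb : ∀ k, 0 < b k)
    (k : Fin p) : Integrable (fun v => v k) (rhoC σ τ p a b) := by
  have := fun k => isFiniteMeasure_gammaM (ha k) (hb k)
  rw [integrable_rhoC_iff (by fun_prop)]
  exact (integrable_id_rho0 hσ hτ).mul_prod
    (integrable_eval (μ := fun k => gammaM (a k) (b k)) (integrable_id_gammaM (ha k) (hb k)))

lemma integrable_sum_mul_rhoC (hσ : σ < 1) (hτ : 0 < τ) (ha : ∀ k, 0 < a k)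
    (hb : ∀ k, 0 < b k) (t : Fin p → ℝ) :
    Integrable (fun v => ∑ k, t k * v k) (rhoC σ τ p a b) :=
  integrable_finsetSum _ fun k _ => (integrable_eval_rhoC hσ hτ ha hb k).const_mul (t k)

lemma integrable_psi_integrand (hσ : σ < 1) (hτ : 0 < τ) (ha : ∀ k, 0 < a k)
    (hb : ∀ k, 0 < b k) {t : Fin p → ℝ} (ht : ∀ k, 0 ≤ t k) :
    Integrable (fun v => 1 - Real.exp (-∑ k, t k * v k)) (rhoC σ τ p a b) := by
  refine (integrable_sum_mul_rhoC hσ hτ ha hb t).mono'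
    (Measurable.aestronglyMeasurable (by fun_prop)) ?_
  filter_upwards [ae_pos_rhoC ha hb] with v hv
  have h0 : 0 ≤ ∑ k, t k * v k := Finset.sum_nonneg fun k _ => mul_nonneg (ht k) (hv k).le
  rw [Real.norm_of_nonneg (sub_nonneg.2 (Real.exp_le_one_iff.2 (by linarith)))]
  linarith [Real.add_one_le_exp (-∑ k, t k * v k)]

lemma psi_mono (hσ : σ < 1) (hτ : 0 < τ) (ha : ∀ k, 0 < a k) (hb : ∀ k, 0 < b k)
    {s t : Fin p → ℝ} (hs : ∀ k, 0 ≤ s k) (hst : ∀ k, s k ≤ t k) :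
    psi σ τ p a b s ≤ psi σ τ p a b t := by
  refine integral_mono_ae (integrable_psi_integrand hσ hτ ha hb hs)
    (integrable_psi_integrand hσ hτ ha hb fun k => (hs k).trans (hst k)) ?_
  filter_upwards [ae_pos_rhoC ha hb] with v hv
  have : ∑ k, s k * v k ≤ ∑ k, t k * v k :=
    Finset.sum_le_sum fun k _ => mul_le_mul_of_nonneg_right (hst k) (hv k).le
  gcongr

lemma psi_nonneg (hσ : σ < 1) (hτ : 0 < τ) (ha : ∀ k, 0 < a k) (hb : ∀ k, 0 < b k)
    {t : Fin p → ℝ} (ht : ∀ k, 0 ≤ t k) : 0 ≤ psi σ τ p a b t := by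
  simpa [psi] using psi_mono hσ hτ ha hb (s := 0) (fun _ => le_rfl) ht

lemma psi_pos (hσ : σ < 1) (hτ : 0 < τ) (hp : 1 ≤ p) (ha : ∀ k, 0 < a k) (hb : ∀ k, 0 < b k)
    {t : Fin p → ℝ} (ht : ∀ k, 0 < t k) : 0 < psi σ τ p a b t := by
  refine integral_pos_of_ae_pos (rhoC_ne_zero hσ ha hb)
    (integrable_psi_integrand hσ hτ ha hb fun k => (ht k).le) ?_
  filter_upwards [ae_pos_rhoC ha hb] with v hv
  have : 0 < ∑ k, t k * v k :=
    Finset.sum_pos (fun k _ => mul_pos (ht k) (hv k)) ⟨⟨0, hp⟩, Finset.mem_univ _⟩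
  exact sub_pos.2 (Real.exp_lt_one_iff.2 (by linarith))

lemma psi_le (hσ : σ < 1) (hτ : 0 < τ) (ha : ∀ k, 0 < a k) (hb : ∀ k, 0 < b k)
    {t : Fin p → ℝ} (ht : ∀ k, 0 ≤ t k) :
    psi σ τ p a b t ≤ ∑ k, t k * ∫ v, v k ∂(rhoC σ τ p a b) := by
  calc psi σ τ p a b t ≤ ∫ v, ∑ k, t k * v k ∂(rhoC σ τ p a b) := by
        refine integral_mono_ae (integrable_psi_integrand hσ hτ ha hb ht)
          (integrable_sum_mul_rhoC hσ hτ ha hb t) (Eventually.of_forall fun v => ?_)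
        simp only
        linarith [Real.add_one_le_exp (-∑ k, t k * v k)]
    _ = _ := by
        rw [integral_finsetSum _ fun k _ => (integrable_eval_rhoC hσ hτ ha hb k).const_mul (t k)]
        simp only [integral_const_mul]

lemma measurable_psi : Measurable (psi σ τ p a b) := by
  have : StronglyMeasurable (Function.uncurry fun (t v : Fin p → ℝ) =>
      1 - Real.exp (-∑ k, t k * v k)) := by
    apply Measurable.stronglyMeasurable
    unfold Function.uncurry
    fun_prop
  exact this.integral_prod_right.measurable

variable {α : ℝ}

lemma nodesIntegral_eq (T : ℝ) :
    nodesIntegral σ τ p a b α T =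
      ∫ x, (1 - Real.exp (-α * psi σ τ p a b (fun k => 2 * T * (x.1 * x.2 k))))
        ∂((rho0 σ τ).prod (Measure.pi fun k => gammaM (a k) (b k))) := by
  refine integral_rhoC (f := fun w => 1 - Real.exp (-α * psi σ τ p a b fun k => 2 * T * w k)) ?_
  exact measurable_const.sub (((measurable_psi.comp (by fun_prop)).const_mul _).exp)

lemma integrand_le_mul_min (hσ : σ < 1) (hτ : 0 < τ) (ha : ∀ k, 0 < a k) (hb : ∀ k, 0 < b k)
    (hα : 0 < α) {T : ℝ} (hT : 0 < T) {w : ℝ} (hw : 0 < w) {β : Fin p → ℝ}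
    (hβ : ∀ k, 0 < β k) :
    1 - Real.exp (-α * psi σ τ p a b (fun k => 2 * T * (w * β k))) ≤
      min 1 (T * w) * (1 + ∑ k, (2 * α * ∫ v, v k ∂(rhoC σ τ p a b)) * β k) := by
  have hm : ∀ k, 0 ≤ ∫ v, v k ∂(rhoC σ τ p a b) := fun k =>
    integral_nonneg_of_ae ((ae_pos_rhoC ha hb).mono fun v hv => (hv k).le)
  set S := ∑ k, (2 * α * ∫ v, v k ∂(rhoC σ τ p a b)) * β k with hS
  have hS0 : 0 ≤ S := Finset.sum_nonneg fun k _ => by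
    have := hm k; have := hβ k; positivity
  have h1 := psi_le (σ := σ) (τ := τ) (a := a) (b := b) hσ hτ ha hb
    (t := fun k => 2 * T * (w * β k)) (fun k => by have := hβ k; positivity)
  have h2 : α * ∑ k, 2 * T * (w * β k) * ∫ v, v k ∂(rhoC σ τ p a b) = T * w * S := by
    rw [hS, Finset.mul_sum, Finset.mul_sum]
    exact Finset.sum_congr rfl fun k _ => by ring
  have h3 := Real.add_one_le_exp (-α * psi σ τ p a b (fun k => 2 * T * (w * β k)))
  have h4 := Real.exp_pos (-α * psi σ τ p a b (fun k => 2 * T * (w * β k)))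
  have h5 := mul_le_mul_of_nonneg_left h1 hα.le
  have h6 : 0 < T * w := by positivity
  rcases min_cases 1 (T * w) with ⟨h, -⟩ | ⟨h, -⟩ <;> rw [h] <;> linarith

lemma integrable_mul_min (hσ : σ < 1) (hτ : 0 < τ) (ha : ∀ k, 0 < a k) (hb : ∀ k, 0 < b k)
    (c : Fin p → ℝ) {T : ℝ} (hT : 0 < T) :
    Integrable (fun x : ℝ × (Fin p → ℝ) => min 1 (T * x.1) * (1 + ∑ k, c k * x.2 k))
      ((rho0 σ τ).prod (Measure.pi fun k => gammaM (a k) (b k))) := by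
  have := fun k => isFiniteMeasure_gammaM (ha k) (hb k)
  refine (integrable_min_one_mul_rho0 hσ hτ hT).mul_prod (g := fun β : Fin p → ℝ => 1 + ∑ k, c k * β k) ?_
  refine (integrable_const _).add (integrable_finsetSum _ fun k _ => Integrable.const_mul ?_ _)
  exact integrable_eval (μ := fun k => gammaM (a k) (b k)) (integrable_id_gammaM (ha k) (hb k))

lemma integrand_nonneg (hσ : σ < 1) (hτ : 0 < τ) (ha : ∀ k, 0 < a k) (hb : ∀ k, 0 < b k)
    (hα : 0 < α) {t : Fin p → ℝ} (ht : ∀ k, 0 ≤ t k) :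
    0 ≤ 1 - Real.exp (-α * psi σ τ p a b t) := by
  have := mul_nonneg hα.le (psi_nonneg hσ hτ ha hb ht)
  exact sub_nonneg.2 (Real.exp_le_one_iff.2 (by linarith))

lemma exists_nodesIntegral_le (hσ0 : 0 < σ) (hσ : σ < 1) (hτ : 0 < τ) (ha : ∀ k, 0 < a k)
    (hb : ∀ k, 0 < b k) (hα : 0 < α) :
    ∃ c, ∀ T > 0, nodesIntegral σ τ p a b α T ≤ c * T ^ σ := by
  have := fun k => isFiniteMeasure_gammaM (ha k) (hb k)
  set g : (Fin p → ℝ) → ℝ := fun β => 1 + ∑ k, (2 * α * ∫ v, v k ∂(rhoC σ τ p a b)) * β k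
  have hg : 0 ≤ ∫ β, g β ∂(Measure.pi fun k => gammaM (a k) (b k)) := by
    refine integral_nonneg_of_ae ((ae_pos_pi_gammaM ha hb).mono fun β hβ => ?_)
    refine add_nonneg zero_le_one (Finset.sum_nonneg fun k _ => ?_)
    have hm : 0 ≤ ∫ v, v k ∂(rhoC σ τ p a b) :=
      integral_nonneg_of_ae ((ae_pos_rhoC ha hb).mono fun v hv => (hv k).le)
    have := hβ k
    positivity
  refine ⟨(∫ u in Set.Ioi (0 : ℝ), u ^ (-1 - σ) * min 1 u) / Real.Gamma (1 - σ) *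
    ∫ β, g β ∂(Measure.pi fun k => gammaM (a k) (b k)), fun T hT => ?_⟩
  rw [nodesIntegral_eq]
  calc _ ≤ ∫ x, min 1 (T * x.1) * g x.2
        ∂((rho0 σ τ).prod (Measure.pi fun k => gammaM (a k) (b k))) := by
        refine integral_mono_of_nonneg ?_ (integrable_mul_min hσ hτ ha hb _ hT) ?_
        · filter_upwards [ae_pos_prod ha hb] with x ⟨hw, hβ⟩
          exact integrand_nonneg hσ hτ ha hb hα fun k => by have := hβ k; positivity
        · filter_upwards [ae_pos_prod ha hb] with x ⟨hw, hβ⟩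
          exact integrand_le_mul_min hσ hτ ha hb hα hT hw hβ
    _ = (∫ w, min 1 (T * w) ∂(rho0 σ τ)) *
        ∫ β, g β ∂(Measure.pi fun k => gammaM (a k) (b k)) :=
        integral_prod_mul (fun w => min 1 (T * w)) g
    _ ≤ _ := by
        rw [mul_right_comm]
        exact mul_le_mul_of_nonneg_right (integral_min_one_mul_rho0_le hσ0 hσ hτ hT) hg

lemma integrable_nodes_integrand (hσ : σ < 1) (hτ : 0 < τ) (ha : ∀ k, 0 < a k)
    (hb : ∀ k, 0 < b k) (hα : 0 < α) {T : ℝ} (hT : 0 < T) :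
    Integrable (fun x : ℝ × (Fin p → ℝ) =>
        1 - Real.exp (-α * psi σ τ p a b (fun k => 2 * T * (x.1 * x.2 k))))
      ((rho0 σ τ).prod (Measure.pi fun k => gammaM (a k) (b k))) := by
  refine (integrable_mul_min hσ hτ ha hb
    (fun k => 2 * α * ∫ v, v k ∂(rhoC σ τ p a b)) hT).mono' ?_ ?_
  · exact (measurable_const.sub
      ((measurable_psi.comp (by fun_prop)).const_mul _).exp).aestronglyMeasurable
  · filter_upwards [ae_pos_prod ha hb] with x ⟨hw, hβ⟩
    rw [Real.norm_of_nonneg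
      (integrand_nonneg hσ hτ ha hb hα fun k => by have := hβ k; positivity)]
    exact integrand_le_mul_min hσ hτ ha hb hα hT hw hβ

lemma exists_le_nodesIntegral (hσ0 : 0 < σ) (hσ : σ < 1) (hτ : 0 < τ) (hp : 1 ≤ p)
    (ha : ∀ k, 0 < a k) (hb : ∀ k, 0 < b k) (hα : 0 < α) :
    ∃ c > 0, ∀ T ≥ 1, c * T ^ σ ≤ nodesIntegral σ τ p a b α T := by
  have := fun k => isFiniteMeasure_gammaM (ha k) (hb k)
  have hΓ := Real.Gamma_pos_of_pos (sub_pos.2 hσ)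
  set G : (Fin p → ℝ) → ℝ := fun β => 1 - Real.exp (-α * psi σ τ p a b fun k => 2 * β k)
  have hGm : Measurable G :=
    measurable_const.sub ((measurable_psi.comp (by fun_prop)).const_mul _).exp
  have hG0 : ∀ β, (∀ k, 0 < β k) → 0 < G β := fun β hβ => by
    have h1 := psi_pos (σ := σ) (τ := τ) (a := a) (b := b) hσ hτ hp ha hb
      (t := fun k => 2 * β k) fun k => by have := hβ k; positivity
    have h2 := mul_pos hα h1
    exact sub_pos.2 (Real.exp_lt_one_iff.2 (by linarith))
  have hGi : Integrable G (Measure.pi fun k => gammaM (a k) (b k)) := by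
    refine (integrable_const (1 : ℝ)).mono' hGm.aestronglyMeasurable ?_
    filter_upwards [ae_pos_pi_gammaM ha hb] with β hβ
    rw [Real.norm_of_nonneg (hG0 β hβ).le]
    exact sub_le_self _ (Real.exp_pos _).le
  have hG : 0 < ∫ β, G β ∂(Measure.pi fun k => gammaM (a k) (b k)) := by
    refine integral_pos_of_ae_pos ?_ hGi ((ae_pos_pi_gammaM ha hb).mono hG0)
    intro h
    apply rhoC_ne_zero (τ := τ) hσ ha hb
    rw [rhoC, h, Measure.prod_zero, Measure.map_zero]
  refine ⟨2 ^ (-1 - σ) * Real.exp (-τ * 2) / Real.Gamma (1 - σ) *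
    ∫ β, G β ∂(Measure.pi fun k => gammaM (a k) (b k)), by positivity, fun T hT => ?_⟩
  have hT0 : 0 < T := by linarith
  rw [nodesIntegral_eq, mul_right_comm]
  refine (mul_le_mul_of_nonneg_right (le_integral_indicator_rho0 hσ0 hσ hτ hT) hG.le).trans ?_
  rw [← integral_prod_mul]
  refine integral_mono_of_nonneg ?_ (integrable_nodes_integrand hσ hτ ha hb hα hT0) ?_
  · filter_upwards [ae_pos_prod ha hb] with x ⟨hw, hβ⟩
    exact mul_nonneg (Set.indicator_nonneg (by simp) _) (hG0 _ hβ).le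
  · filter_upwards [ae_pos_prod ha hb] with x ⟨hw, hβ⟩
    by_cases hx : x.1 ∈ Set.Ioc (1 / T) (2 / T)
    · have h1 := hx.1
      rw [div_lt_iff₀ hT0] at h1
      have h2 : psi σ τ p a b (fun k => 2 * x.2 k) ≤
          psi σ τ p a b (fun k => 2 * T * (x.1 * x.2 k)) := by
        refine psi_mono hσ hτ ha hb (fun k => by have := hβ k; positivity) fun k => ?_
        nlinarith [hβ k]
      have h3 := mul_le_mul_of_nonneg_left h2 hα.le
      simp only [Set.indicator_of_mem hx, Pi.one_apply, one_mul, G]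
      gcongr 1 - Real.exp ?_
      linarith
    · simp only [Set.indicator_of_notMem hx, zero_mul]
      exact integrand_nonneg hσ hτ ha hb hα fun k => by have := hβ k; positivity

end Compound

/-- For `0 < σ < 1` and fixed `α > 0`, `f(T) = ∫ (1 − e^{−α ψ(2Tw)}) ρ(dw) = Θ(T^σ)` as
`T → ∞`; consequently `E[V_{α,T}] = α f(T) = Θ(T^σ)` as `T → ∞`. -/
theorem nodes_growth_sigma_pos (σ τ : ℝ) (hσ0 : 0 < σ) (hσ : σ < 1) (hτ : 0 < τ) (p : ℕ)
    (hp : 1 ≤ p) (a b : Fin p → ℝ) (ha : ∀ k, 0 < a k) (hb : ∀ k, 0 < b k)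
    (α : ℝ) (hα : 0 < α) :
    (∃ c₁ c₂ T₀ : ℝ, 0 < c₁ ∧ c₁ ≤ c₂ ∧ 0 < T₀ ∧ ∀ T ≥ T₀,
      c₁ * T ^ σ ≤ nodesIntegral σ τ p a b α T ∧
      nodesIntegral σ τ p a b α T ≤ c₂ * T ^ σ) ∧
    (∃ d₁ d₂ T₁ : ℝ, 0 < d₁ ∧ d₁ ≤ d₂ ∧ 0 < T₁ ∧ ∀ T ≥ T₁,
      d₁ * T ^ σ ≤ α * nodesIntegral σ τ p a b α T ∧
      α * nodesIntegral σ τ p a b α T ≤ d₂ * T ^ σ) := by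
  obtain ⟨c₁, hc₁, hlow⟩ := exists_le_nodesIntegral (σ := σ) (τ := τ) hσ0 hσ hτ hp ha hb hα
  obtain ⟨c₂, hup⟩ := exists_nodesIntegral_le (σ := σ) (τ := τ) hσ0 hσ hτ ha hb hα
  have hc : c₁ ≤ c₂ := by simpa using (hlow 1 le_rfl).trans (hup 1 one_pos)
  refine ⟨⟨c₁, c₂, 1, hc₁, hc, one_pos, fun T hT => ⟨hlow T hT, hup T (by linarith)⟩⟩,
    α * c₁, α * c₂, 1, by positivity, by gcongr, one_pos, fun T hT => ?_⟩
  simp only [mul_assoc]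
  exact ⟨mul_le_mul_of_nonneg_left (hlow T hT) hα.le,
    mul_le_mul_of_nonneg_left (hup T (by linarith)) hα.le⟩
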